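/- arXiv:math/0607410 — 2 statements merged into one kernel-verified Lean document; each statement's English description precedes it below -/
import Mathlib

section
/- Aomoto's integral formula for integer exponent: Let n ≥ 1 and k ≥ 1 be integers, let a, b > 0 be real numbers and y ∈ ℝ. Then 𝒜_n^{a,b;k}(y) = (−1)^n · 𝒮_n(a,b;k) · ( (a/k)_n / ((a/k)+(b/k)+n−1)_n ) · ∑_{i=0}^n [ (−n)_i · ((a/k)+(b/k)+n−1)_i / ( (a/k)_i · i! ) ] · y^i, where the finite sum is the hypergeometric polynomial ₂F₁(−n, n+(a/k)+(b/k)−1; a/k; y), which equals (−2)^{−n}·𝒮_n(a,b;k) times the monic Jacobi polynomial P_n^{(a/k)−1,(b/k)−1}(1−2y). -/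
open MeasureTheory

/-- The Vandermonde product `Δ(x) = ∏_{i<j} (x_j - x_i)`. -/
def vandermonde {n : ℕ} (x : Fin n → ℝ) : ℝ :=
  ∏ p ∈ Finset.univ.filter (fun p : Fin n × Fin n => p.1 < p.2), (x p.2 - x p.1)

/-- Selberg's integral `𝒮ₙ(a,b;k)` for integer exponent `k`. -/
noncomputable def selberg (n k : ℕ) (a b : ℝ) : ℝ :=
  ∫ x : Fin n → ℝ in Set.univ.pi (fun _ => Set.Icc (0:ℝ) 1),
    vandermonde x ^ (2 * k) * ∏ i, x i ^ (a - 1) * (1 - x i) ^ (b - 1)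

/-- Aomoto's integral `𝒜ₙ^{a,b;k}(y)` for integer exponent `k`. -/
noncomputable def aomoto (n k : ℕ) (a b y : ℝ) : ℝ :=
  ∫ x : Fin n → ℝ in Set.univ.pi (fun _ => Set.Icc (0:ℝ) 1),
    vandermonde x ^ (2 * k) * ∏ i, (y - x i) * x i ^ (a - 1) * (1 - x i) ^ (b - 1)

/-- The Pochhammer symbol `(c)_m = c (c+1) ⋯ (c+m-1)` of a real number `c`. -/
def poch (c : ℝ) (m : ℕ) : ℝ := ∏ j ∈ Finset.range m, (c + j)

/-- The linear functional on polynomials sending the monomial `X^d` to `∏ i, μ (d i)`. -/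
noncomputable def momentFunctional (σ : Type*) [Fintype σ] (μ : ℕ → ℝ) :
    MvPolynomial σ ℝ →ₗ[ℝ] ℝ :=
  (MvPolynomial.basisMonomials σ ℝ).constr ℝ fun d => ∏ i, μ (d i)

section MomentFunctional

variable {σ : Type*} [Fintype σ] {μ : ℕ → ℝ}

lemma momentFunctional_monomial (d : σ →₀ ℕ) (r : ℝ) :
    momentFunctional σ μ (MvPolynomial.monomial d r) = r * ∏ i, μ (d i) := by
  have h : MvPolynomial.monomial d r = r • MvPolynomial.basisMonomials σ ℝ d := by
    simp [MvPolynomial.smul_monomial]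
  rw [h, map_smul, momentFunctional, Module.Basis.constr_basis, smul_eq_mul]

lemma momentFunctional_rename (e : Equiv.Perm σ) (p : MvPolynomial σ ℝ) :
    momentFunctional σ μ (MvPolynomial.rename e p) = momentFunctional σ μ p := by
  induction p using MvPolynomial.induction_on' with
  | monomial d r =>
    rw [MvPolynomial.rename_monomial, momentFunctional_monomial, momentFunctional_monomial,
      ← Equiv.prod_comp e]
    simp [Finsupp.mapDomain_apply e.injective]
  | add p q hp hq =>
    rw [map_add, map_add, map_add, hp, hq]

/-- Integration by parts against a weight whose moments satisfy the beta recurrence. -/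
lemma momentFunctional_integration_by_parts {a b : ℝ}
    (hμ : ∀ m : ℕ, (a + b + m) * μ (m + 1) = (a + m) * μ m) (i : σ) (p : MvPolynomial σ ℝ) :
    momentFunctional σ μ ((1 - MvPolynomial.X i) * (MvPolynomial.X i * MvPolynomial.pderiv i p))
      + a * momentFunctional σ μ p
      - (a + b) * momentFunctional σ μ (MvPolynomial.X i * p) = 0 := by
  classical
  induction p using MvPolynomial.induction_on' with
  | monomial d r =>
    have h₁ : momentFunctional σ μ (MvPolynomial.monomial d r) =
        r * (μ (d i) * ∏ j ∈ Finset.univ.erase i, μ (d j)) := by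
      rw [momentFunctional_monomial,
        Finset.mul_prod_erase _ (fun j => μ (d j)) (Finset.mem_univ i)]
    have h₂ : momentFunctional σ μ (MvPolynomial.X i * MvPolynomial.monomial d r) =
        r * (μ (d i + 1) * ∏ j ∈ Finset.univ.erase i, μ (d j)) := by
      rw [← pow_one (MvPolynomial.X i), ← MvPolynomial.monomial_single_add, momentFunctional_monomial,
        ← Finset.mul_prod_erase _ _ (Finset.mem_univ i)]
      congr 2
      · simp [add_comm]
      · refine Finset.prod_congr rfl fun j hj => ?_
        simp [(Finset.ne_of_mem_erase hj).symm]
    rw [MvPolynomial.X_mul_pderiv_monomial, sub_mul, one_mul, mul_smul_comm, map_sub,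
      map_nsmul, map_nsmul, h₁, h₂, nsmul_eq_mul, nsmul_eq_mul]
    linear_combination (-r * ∏ j ∈ Finset.univ.erase i, μ (d j)) * hμ (d i)
  | add p q hp hq =>
    simp only [map_add, mul_add] at *
    linarith

end MomentFunctional

lemma Derivation.map_prod_eq_sum {R A ι : Type*} [CommRing R] [CommRing A] [Algebra R A]
    [DecidableEq ι] (D : Derivation R A A) (s : Finset ι) (f : ι → A) :
    D (∏ i ∈ s, f i) = ∑ i ∈ s, (∏ j ∈ s.erase i, f j) * D (f i) := by
  induction s using Finset.induction_on with
  | empty => simp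
  | insert i s hi ih =>
    rw [Finset.prod_insert hi, Derivation.leibniz, ih, Finset.sum_insert hi,
      Finset.erase_insert hi, add_comm, smul_eq_mul, smul_eq_mul, Finset.mul_sum]
    congr 1
    refine Finset.sum_congr rfl fun j hj => ?_
    rw [Finset.erase_insert_of_ne (by rintro rfl; exact hi hj),
      Finset.prod_insert (by simp [hi]), mul_assoc]

/-- The Vandermonde product as a polynomial. -/
noncomputable def vandermondePoly (n : ℕ) : MvPolynomial (Fin n) ℝ :=
  (Matrix.vandermonde (MvPolynomial.X : Fin n → MvPolynomial (Fin n) ℝ)).det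

lemma eval_vandermondePoly {n : ℕ} (x : Fin n → ℝ) :
    MvPolynomial.eval x (vandermondePoly n) = vandermonde x := by
  rw [vandermondePoly, Matrix.det_vandermonde, vandermonde, Finset.prod_filter,
    Fintype.prod_prod_type, map_prod]
  refine Finset.prod_congr rfl fun i _ => ?_
  rw [map_prod, ← Finset.prod_filter]
  refine Finset.prod_congr (by ext; simp) fun j _ => by simp

lemma rename_vandermondePoly_pow {n : ℕ} (k : ℕ) (e : Equiv.Perm (Fin n)) :
    MvPolynomial.rename e (vandermondePoly n ^ (2 * k)) = vandermondePoly n ^ (2 * k) := by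
  have h : MvPolynomial.rename e (vandermondePoly n) =
      ((Equiv.Perm.sign e : ℤ) : MvPolynomial (Fin n) ℝ) * vandermondePoly n := by
    rw [vandermondePoly, ← Matrix.det_permute, AlgHom.map_det]
    congr 1
    ext i j
    simp [Matrix.vandermonde_apply]
  rw [map_pow, h, mul_pow, pow_mul, pow_mul]
  rcases Int.units_eq_one_or (Equiv.Perm.sign e) with h | h <;> simp [h]

lemma exists_pderiv_vandermondePoly_pow (N : ℕ) {k : ℕ} (hk : 1 ≤ k) :
    ∃ Q : Fin N → MvPolynomial (Fin (N + 1)) ℝ,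
      MvPolynomial.pderiv 0 (vandermondePoly (N + 1) ^ (2 * k)) = (2 * k) • ∑ j, Q j ∧
      ∀ j, (MvPolynomial.X 0 - MvPolynomial.X j.succ) * Q j =
        vandermondePoly (N + 1) ^ (2 * k) := by
  obtain ⟨R, hR0, hR⟩ : ∃ R : MvPolynomial (Fin (N + 1)) ℝ, MvPolynomial.pderiv 0 R = 0 ∧
      vandermondePoly (N + 1) =
        (∏ j : Fin N, (MvPolynomial.X j.succ - MvPolynomial.X 0)) * R := by
    refine ⟨∏ i : Fin N, ∏ j ∈ Finset.Ioi i,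
      (MvPolynomial.X j.succ - MvPolynomial.X i.succ), ?_, ?_⟩
    · simp [Derivation.map_prod_eq_sum, MvPolynomial.pderiv_X]
    · simp only [vandermondePoly, Matrix.det_vandermonde, Fin.prod_univ_succ, Fin.prod_Ioi_zero,
        Fin.prod_Ioi_succ]
  refine ⟨fun j => -(vandermondePoly (N + 1) ^ (2 * k - 1) *
    ((∏ i ∈ Finset.univ.erase j, (MvPolynomial.X i.succ - MvPolynomial.X 0)) * R)), ?_, ?_⟩
  · have h : MvPolynomial.pderiv 0 (vandermondePoly (N + 1)) = -∑ j : Fin N,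
        (∏ i ∈ Finset.univ.erase j, (MvPolynomial.X i.succ - MvPolynomial.X 0)) * R := by
      rw [hR, MvPolynomial.pderiv_mul, hR0, mul_zero, add_zero, Derivation.map_prod_eq_sum]
      simp [MvPolynomial.pderiv_X, Finset.sum_mul]
    rw [MvPolynomial.pderiv_pow, h, Finset.sum_neg_distrib, ← Finset.mul_sum]
    rw [nsmul_eq_mul]
    ring
  · intro j
    have hV : vandermondePoly (N + 1) = (MvPolynomial.X j.succ - MvPolynomial.X 0) *
        ((∏ i ∈ Finset.univ.erase j, (MvPolynomial.X i.succ - MvPolynomial.X 0)) * R) := by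
      rw [hR, ← mul_assoc, Finset.mul_prod_erase Finset.univ
        (fun i : Fin N => MvPolynomial.X i.succ - MvPolynomial.X 0) (Finset.mem_univ j)]
    rw [← Nat.sub_add_cancel (show 1 ≤ 2 * k by omega), pow_succ, Nat.add_sub_cancel]
    linear_combination (-vandermondePoly (N + 1) ^ (2 * k - 1)) * hV

/-- The Selberg average of the monomial `∏ i ∈ S, x i`, expressed through moments. -/
noncomputable def selbergMoment (n k : ℕ) (μ : ℕ → ℝ) (S : Finset (Fin n)) : ℝ :=
  momentFunctional (Fin n) μ (vandermondePoly n ^ (2 * k) * ∏ i ∈ S, MvPolynomial.X i)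

lemma selbergMoment_map {n k : ℕ} {μ : ℕ → ℝ} (e : Equiv.Perm (Fin n)) (S : Finset (Fin n)) :
    selbergMoment n k μ (S.map e.toEmbedding) = selbergMoment n k μ S := by
  unfold selbergMoment
  rw [← momentFunctional_rename e (_ * ∏ i ∈ S, MvPolynomial.X i),
    map_mul (MvPolynomial.rename e), rename_vandermondePoly_pow]
  simp [map_prod]

section Recurrence

variable {N k : ℕ} {μ : ℕ → ℝ} {j : Fin N}

lemma rename_swap_prod_X_succ {T : Finset (Fin N)} (hj : j ∉ T) :
    MvPolynomial.rename (Equiv.swap (0 : Fin (N + 1)) j.succ)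
      (∏ i ∈ T, MvPolynomial.X i.succ : MvPolynomial (Fin (N + 1)) ℝ) =
      ∏ i ∈ T, MvPolynomial.X i.succ := by
  rw [map_prod]
  refine Finset.prod_congr rfl fun i hi => ?_
  rw [MvPolynomial.rename_X, Equiv.swap_apply_of_ne_of_ne (Fin.succ_ne_zero i)]
  rintro h
  exact hj (Fin.succ_injective _ h ▸ hi)

variable {q : MvPolynomial (Fin (N + 1)) ℝ}

lemma rename_swap_of_sub_mul_eq
    (hq : (MvPolynomial.X 0 - MvPolynomial.X j.succ) * q = vandermondePoly (N + 1) ^ (2 * k)) :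
    MvPolynomial.rename (Equiv.swap (0 : Fin (N + 1)) j.succ) q = -q := by
  have h := congrArg (MvPolynomial.rename (Equiv.swap (0 : Fin (N + 1)) j.succ)) hq
  rw [rename_vandermondePoly_pow, ← hq, map_mul, map_sub, MvPolynomial.rename_X,
    MvPolynomial.rename_X, Equiv.swap_apply_left, Equiv.swap_apply_right] at h
  have h0 : (MvPolynomial.X 0 - MvPolynomial.X j.succ : MvPolynomial (Fin (N + 1)) ℝ) ≠ 0 :=
    sub_ne_zero.mpr fun h => Fin.succ_ne_zero j (MvPolynomial.X_injective h).symm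
  refine mul_left_cancel₀ h0 ?_
  linear_combination -h

lemma two_mul_momentFunctional_of_notMem
    (hq : (MvPolynomial.X 0 - MvPolynomial.X j.succ) * q = vandermondePoly (N + 1) ^ (2 * k))
    {T : Finset (Fin N)} (hj : j ∉ T) :
    2 * momentFunctional (Fin (N + 1)) μ ((1 - MvPolynomial.X 0) *
        (MvPolynomial.X 0 * (q * ∏ i ∈ T, MvPolynomial.X i.succ))) =
      momentFunctional (Fin (N + 1)) μ
          (vandermondePoly (N + 1) ^ (2 * k) * ∏ i ∈ T, MvPolynomial.X i.succ)
        - 2 * momentFunctional (Fin (N + 1)) μ (MvPolynomial.X 0 *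
          (vandermondePoly (N + 1) ^ (2 * k) * ∏ i ∈ T, MvPolynomial.X i.succ)) := by
  set W := vandermondePoly (N + 1) ^ (2 * k) with hW
  set P : MvPolynomial (Fin (N + 1)) ℝ := ∏ i ∈ T, MvPolynomial.X i.succ with hP
  have h₁ := momentFunctional_rename (μ := μ) (Equiv.swap (0 : Fin (N + 1)) j.succ)
    ((1 - MvPolynomial.X 0) * (MvPolynomial.X 0 * (q * P)))
  have h₂ := momentFunctional_rename (μ := μ) (Equiv.swap (0 : Fin (N + 1)) j.succ)
    (MvPolynomial.X 0 * (W * P))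
  simp only [map_mul, map_sub, map_one, MvPolynomial.rename_X, Equiv.swap_apply_left,
    rename_swap_of_sub_mul_eq hq, hP, rename_swap_prod_X_succ hj, hW,
    rename_vandermondePoly_pow] at h₁ h₂
  rw [← hP] at h₁ h₂
  rw [← hW] at h₂
  have h₃ : (1 - MvPolynomial.X 0) * (MvPolynomial.X 0 * (q * P)) +
      (1 - MvPolynomial.X j.succ) * (MvPolynomial.X j.succ * (-q * P)) =
      W * P - MvPolynomial.X 0 * (W * P) - MvPolynomial.X j.succ * (W * P) := by
    linear_combination (P * (1 - MvPolynomial.X 0 - MvPolynomial.X j.succ)) * hq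
  have h₄ := congrArg (momentFunctional (Fin (N + 1)) μ) h₃
  rw [map_add, map_sub, map_sub] at h₄
  linarith

lemma two_mul_momentFunctional_of_mem
    (hq : (MvPolynomial.X 0 - MvPolynomial.X j.succ) * q = vandermondePoly (N + 1) ^ (2 * k))
    {T : Finset (Fin N)} (hj : j ∈ T) :
    2 * momentFunctional (Fin (N + 1)) μ ((1 - MvPolynomial.X 0) *
        (MvPolynomial.X 0 * (q * ∏ i ∈ T, MvPolynomial.X i.succ))) =
      -momentFunctional (Fin (N + 1)) μ (MvPolynomial.X 0 *
          (vandermondePoly (N + 1) ^ (2 * k) * ∏ i ∈ T, MvPolynomial.X i.succ)) := by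
  rw [← Finset.mul_prod_erase T _ hj]
  set W := vandermondePoly (N + 1) ^ (2 * k) with hW
  set P : MvPolynomial (Fin (N + 1)) ℝ := ∏ i ∈ T.erase j, MvPolynomial.X i.succ with hP
  have h₁ := momentFunctional_rename (μ := μ) (Equiv.swap (0 : Fin (N + 1)) j.succ)
    ((1 - MvPolynomial.X 0) * (MvPolynomial.X 0 * (q * (MvPolynomial.X j.succ * P))))
  simp only [map_mul, map_sub, map_one, MvPolynomial.rename_X, Equiv.swap_apply_left,
    Equiv.swap_apply_right, rename_swap_of_sub_mul_eq hq, hP,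
    rename_swap_prod_X_succ (Finset.notMem_erase j T)] at h₁
  rw [← hP] at h₁
  have h₃ : (1 - MvPolynomial.X 0) * (MvPolynomial.X 0 * (q * (MvPolynomial.X j.succ * P))) +
      (1 - MvPolynomial.X j.succ) *
        (MvPolynomial.X j.succ * (-q * (MvPolynomial.X 0 * P))) =
      -(MvPolynomial.X 0 * (W * (MvPolynomial.X j.succ * P))) := by
    linear_combination (-P * MvPolynomial.X 0 * MvPolynomial.X j.succ) * hq
  have h₄ := congrArg (momentFunctional (Fin (N + 1)) μ) h₃
  rw [map_add, map_neg] at h₄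
  linarith

/-- Aomoto's recurrence for the moments of squarefree monomials. -/
lemma selbergMoment_insert_zero {a b : ℝ} (hk : 1 ≤ k)
    (hμ : ∀ m : ℕ, (a + b + m) * μ (m + 1) = (a + m) * μ m) (T : Finset (Fin N)) :
    (a + b + k * (2 * N - T.card)) *
        selbergMoment (N + 1) k μ (insert 0 (T.map (Fin.succEmb N))) =
      (a + k * (N - T.card)) * selbergMoment (N + 1) k μ (T.map (Fin.succEmb N)) := by
  obtain ⟨Q, hQ, hQW⟩ := exists_pderiv_vandermondePoly_pow N hk
  have h0 : (0 : Fin (N + 1)) ∉ T.map (Fin.succEmb N) := by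
    simp [Fin.succ_ne_zero]
  have hS := momentFunctional_integration_by_parts hμ (0 : Fin (N + 1))
    (vandermondePoly (N + 1) ^ (2 * k) * ∏ i ∈ T, MvPolynomial.X i.succ)
  have hD : MvPolynomial.pderiv 0
      (∏ i ∈ T, MvPolynomial.X i.succ : MvPolynomial (Fin (N + 1)) ℝ) = 0 := by
    simp [Derivation.map_prod_eq_sum, MvPolynomial.pderiv_X]
  have hsum : 2 * ∑ j, momentFunctional (Fin (N + 1)) μ ((1 - MvPolynomial.X 0) *
        (MvPolynomial.X 0 * (Q j * ∏ i ∈ T, MvPolynomial.X i.succ))) =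
      (N - T.card) * (momentFunctional (Fin (N + 1)) μ
          (vandermondePoly (N + 1) ^ (2 * k) * ∏ i ∈ T, MvPolynomial.X i.succ)
        - 2 * momentFunctional (Fin (N + 1)) μ (MvPolynomial.X 0 *
          (vandermondePoly (N + 1) ^ (2 * k) * ∏ i ∈ T, MvPolynomial.X i.succ)))
      - T.card * momentFunctional (Fin (N + 1)) μ (MvPolynomial.X 0 *
          (vandermondePoly (N + 1) ^ (2 * k) * ∏ i ∈ T, MvPolynomial.X i.succ)) := by
    rw [Finset.mul_sum, ← Finset.sum_add_sum_compl T,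
      Finset.sum_congr rfl fun j hj => two_mul_momentFunctional_of_mem (hQW j) hj,
      Finset.sum_congr (s₁ := Tᶜ) rfl fun j hj =>
        two_mul_momentFunctional_of_notMem (hQW j) (Finset.mem_compl.mp hj),
      Finset.sum_const, Finset.sum_const, Finset.card_compl, Fintype.card_fin, nsmul_eq_mul,
      nsmul_eq_mul, Nat.cast_sub (by simpa using T.card_le_univ)]
    ring
  rw [MvPolynomial.pderiv_mul, hD, mul_zero, add_zero, hQ, smul_mul_assoc, mul_smul_comm,
    mul_smul_comm, map_nsmul, Finset.sum_mul, Finset.mul_sum, Finset.mul_sum, map_sum,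
    nsmul_eq_mul] at hS
  push_cast at hS
  simp only [selbergMoment, Finset.prod_insert h0, Finset.prod_map, Fin.coe_succEmb]
  rw [mul_left_comm (vandermondePoly (N + 1) ^ (2 * k))]
  linear_combination k * hsum - hS

end Recurrence

lemma selbergMoment_eq {n k : ℕ} {μ : ℕ → ℝ} {a b : ℝ} (hk : 1 ≤ k) (ha : 0 < a) (hb : 0 < b)
    (hμ : ∀ m : ℕ, (a + b + m) * μ (m + 1) = (a + m) * μ m) (S : Finset (Fin n)) :
    selbergMoment n k μ S = selbergMoment n k μ ∅ * ∏ j ∈ Finset.range S.card,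
      (a / k + n - 1 - j) / (a / k + b / k + 2 * n - 2 - j) := by
  obtain ⟨m, hm⟩ : ∃ m, S.card = m := ⟨_, rfl⟩
  induction m generalizing S with
  | zero => simp [Finset.card_eq_zero.mp hm]
  | succ m ih =>
    obtain ⟨s, hs⟩ : S.Nonempty := Finset.card_pos.mp (by omega)
    cases n with
    | zero => exact s.elim0
    | succ N =>
      set S' := S.map (Equiv.swap 0 s).toEmbedding with hS'
      have h0 : 0 ∈ S' := by
        simp only [hS', Finset.mem_map_equiv, Equiv.symm_swap, Equiv.swap_apply_left, hs]
      obtain ⟨T, hT⟩ : ∃ T : Finset (Fin N), T.map (Fin.succEmb N) = S'.erase 0 := by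
        refine ⟨(S'.erase 0).preimage Fin.succ (Fin.succ_injective N).injOn, ?_⟩
        ext i
        cases i using Fin.cases <;> simp [Fin.succ_ne_zero]
      have hcard : T.card = m := by
        rw [← Finset.card_map (Fin.succEmb N), hT, Finset.card_erase_of_mem h0, hS',
          Finset.card_map, hm, Nat.add_sub_cancel]
      have hrec := selbergMoment_insert_zero hk hμ T
      rw [ih (T.map (Fin.succEmb N)) (by rw [Finset.card_map, hcard]), hT, Finset.insert_erase h0,
        Finset.card_erase_of_mem h0, hS', selbergMoment_map, Finset.card_map, hm,
        Nat.add_sub_cancel, hcard] at hrec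
      have hmN : (m : ℝ) ≤ N := by
        rw [← hcard]
        exact_mod_cast (by simpa using T.card_le_univ)
      have hk' : (0 : ℝ) < k := by exact_mod_cast hk
      have hne : a + b + k * (2 * N - m) ≠ 0 := by
        have : 0 ≤ (k : ℝ) * (2 * N - m) :=
          mul_nonneg hk'.le (by linarith [Nat.cast_nonneg (α := ℝ) N])
        positivity
      rw [hm, Finset.prod_range_succ, ← mul_assoc]
      refine mul_left_cancel₀ hne (hrec.trans ?_)
      have hden : a / k + b / k + 2 * (N + 1 : ℕ) - 2 - m = (a + b + k * (2 * N - m)) / k := by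
        push_cast
        field_simp
        ring
      have hnum : a / k + (N + 1 : ℕ) - 1 - m = (a + k * (N - m)) / k := by
        push_cast
        field_simp
        ring
      have hquot : (a + b + k * (2 * N - m)) *
          ((a + k * (N - m)) / (a + b + k * (2 * N - m))) = a + k * (N - m) := by
        field_simp
      rw [hden, hnum, div_div_div_cancel_right₀ hk'.ne',
        mul_left_comm (a + b + k * (2 * N - m)), hquot, mul_comm]

section BetaMoments

variable {a b : ℝ}

lemma beta_succ_recurrence (ha : 0 < a) (hb : 0 < b) (m : ℕ) :
    (a + b + m) * ProbabilityTheory.beta (a + (m + 1 : ℕ)) b =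
      (a + m) * ProbabilityTheory.beta (a + m) b := by
  have h1 : a + m ≠ 0 := by positivity
  have h2 : a + m + b ≠ 0 := by positivity
  have h3 : Real.Gamma (a + m + b) ≠ 0 := (Real.Gamma_pos_of_pos (by positivity)).ne'
  rw [ProbabilityTheory.beta, ProbabilityTheory.beta, Nat.cast_succ, ← add_assoc,
    Real.Gamma_add_one h1, add_right_comm (a + m) 1 b, Real.Gamma_add_one h2]
  field_simp
  ring

lemma intervalIntegrable_beta_and_integral_eq (ha : 0 < a) (hb : 0 < b) :
    IntervalIntegrable (fun x : ℝ => x ^ (a - 1) * (1 - x) ^ (b - 1)) volume 0 1 ∧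
      ∫ x : ℝ in 0..1, x ^ (a - 1) * (1 - x) ^ (b - 1) = ProbabilityTheory.beta a b := by
  have hint := Complex.betaIntegral_convergent (u := a) (v := b) (by simpa) (by simpa)
  have hre : ∀ x ∈ Set.Ioc (0 : ℝ) 1,
      (x : ℂ) ^ ((a : ℂ) - 1) * (1 - (x : ℂ)) ^ ((b : ℂ) - 1) =
        ((x ^ (a - 1) * (1 - x) ^ (b - 1) : ℝ) : ℂ) := by
    intro x hx
    rw [Complex.ofReal_mul, Complex.ofReal_cpow hx.1.le, Complex.ofReal_cpow (by linarith [hx.2])]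
    push_cast
    rfl
  rw [intervalIntegrable_iff_integrableOn_Ioc_of_le zero_le_one] at hint ⊢
  refine ⟨?_, ?_⟩
  · refine IntegrableOn.congr_fun hint.re (fun x hx => ?_) measurableSet_Ioc
    simp only [hre x hx, RCLike.re_eq_complex_re, Complex.ofReal_re]
  · rw [ProbabilityTheory.beta_eq_betaIntegralReal a b ha hb, Complex.betaIntegral,
      intervalIntegral.integral_of_le zero_le_one, intervalIntegral.integral_of_le zero_le_one,
      setIntegral_congr_fun measurableSet_Ioc hre, integral_complex_ofReal, Complex.ofReal_re]

lemma integrable_pow_mul_beta_and_integral_eq (ha : 0 < a) (hb : 0 < b) (m : ℕ) :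
    IntegrableOn (fun x : ℝ => x ^ m * (x ^ (a - 1) * (1 - x) ^ (b - 1))) (Set.Icc 0 1) ∧
      ∫ x in Set.Icc (0 : ℝ) 1, x ^ m * (x ^ (a - 1) * (1 - x) ^ (b - 1)) =
        ProbabilityTheory.beta (a + m) b := by
  obtain ⟨h1, h2⟩ := intervalIntegrable_beta_and_integral_eq
    (show 0 < a + m by positivity) hb
  rw [intervalIntegrable_iff_integrableOn_Ioc_of_le zero_le_one] at h1
  rw [intervalIntegral.integral_of_le zero_le_one] at h2
  have heq : ∀ x ∈ Set.Ioc (0 : ℝ) 1, x ^ (a + m - 1) * (1 - x) ^ (b - 1) =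
      x ^ m * (x ^ (a - 1) * (1 - x) ^ (b - 1)) := by
    intro x hx
    rw [← mul_assoc, ← Real.rpow_natCast, ← Real.rpow_add hx.1]
    congr 2
    ring
  rw [integrableOn_Icc_iff_integrableOn_Ioc, integral_Icc_eq_integral_Ioc, ← h2]
  exact ⟨h1.congr_fun heq measurableSet_Ioc, (setIntegral_congr_fun measurableSet_Ioc heq).symm⟩

variable {σ : Type*} [Fintype σ]

lemma integrable_eval_mul_beta_and_integral_eq (ha : 0 < a) (hb : 0 < b)
    (p : MvPolynomial σ ℝ) :
    IntegrableOn (fun x : σ → ℝ => MvPolynomial.eval x p *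
        ∏ i, x i ^ (a - 1) * (1 - x i) ^ (b - 1)) (Set.univ.pi fun _ => Set.Icc (0 : ℝ) 1) ∧
      ∫ x : σ → ℝ in Set.univ.pi (fun _ => Set.Icc (0 : ℝ) 1),
          MvPolynomial.eval x p * ∏ i, x i ^ (a - 1) * (1 - x i) ^ (b - 1) =
        momentFunctional σ (fun m => ProbabilityTheory.beta (a + m) b) p := by
  induction p using MvPolynomial.induction_on' with
  | monomial d r =>
    have heq : (fun x : σ → ℝ => MvPolynomial.eval x (MvPolynomial.monomial d r) *
          ∏ i, x i ^ (a - 1) * (1 - x i) ^ (b - 1)) =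
        fun x => r * ∏ i, (x i ^ d i * (x i ^ (a - 1) * (1 - x i) ^ (b - 1))) := by
      funext x
      rw [MvPolynomial.eval_monomial, Finsupp.prod_fintype _ _ (by simp), mul_assoc,
        ← Finset.prod_mul_distrib]
    rw [heq, momentFunctional_monomial, IntegrableOn, volume_pi, Measure.restrict_pi_pi,
      integral_const_mul,
      integral_fintype_prod_eq_prod
        (fun i (t : ℝ) => t ^ d i * (t ^ (a - 1) * (1 - t) ^ (b - 1)))]
    refine ⟨(Integrable.fintype_prod
      (f := fun i (t : ℝ) => t ^ d i * (t ^ (a - 1) * (1 - t) ^ (b - 1)))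
      fun i => (integrable_pow_mul_beta_and_integral_eq ha hb (d i)).1).const_mul r, ?_⟩
    congr 1
    exact Finset.prod_congr rfl fun i _ =>
      (integrable_pow_mul_beta_and_integral_eq ha hb (d i)).2
  | add p q hp hq =>
    simp only [map_add, add_mul]
    exact ⟨hp.1.add hq.1, by rw [integral_add hp.1 hq.1, hp.2, hq.2]⟩

end BetaMoments

lemma selberg_eq_selbergMoment (n k : ℕ) {a b : ℝ} (ha : 0 < a) (hb : 0 < b) :
    selberg n k a b =
      selbergMoment n k (fun m => ProbabilityTheory.beta (a + m) b) ∅ := by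
  rw [selbergMoment, ← (integrable_eval_mul_beta_and_integral_eq ha hb _).2, selberg]
  simp [eval_vandermondePoly]

lemma aomoto_eq_sum_selbergMoment (n k : ℕ) {a b : ℝ} (ha : 0 < a) (hb : 0 < b) (y : ℝ) :
    aomoto n k a b y = ∑ S ∈ (Finset.univ : Finset (Fin n)).powerset,
      (-1) ^ S.card * y ^ (n - S.card) *
        selbergMoment n k (fun m => ProbabilityTheory.beta (a + m) b) S := by
  have h : vandermondePoly n ^ (2 * k) * ∏ i, (MvPolynomial.C y - MvPolynomial.X i) =
      ∑ S ∈ (Finset.univ : Finset (Fin n)).powerset, ((-1) ^ S.card * y ^ (n - S.card)) •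
        (vandermondePoly n ^ (2 * k) * ∏ i ∈ S, MvPolynomial.X i) := by
    rw [Finset.prod_sub, Finset.mul_sum]
    refine Finset.sum_congr rfl fun S _ => ?_
    rw [Finset.prod_const, Finset.card_sdiff_of_subset (Finset.subset_univ S),
      Finset.card_univ, Fintype.card_fin, MvPolynomial.smul_eq_C_mul]
    simp only [map_mul, map_pow, map_neg, map_one]
    ring
  have h' := (integrable_eval_mul_beta_and_integral_eq ha hb
    (vandermondePoly n ^ (2 * k) * ∏ i, (MvPolynomial.C y - MvPolynomial.X i))).2
  rw [h, map_sum, ← h] at h'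
  simp only [map_smul, smul_eq_mul] at h'
  simp only [selbergMoment]
  rw [← h', aomoto]
  congr 1
  funext x
  simp only [map_mul, map_pow, map_prod, map_sub, MvPolynomial.eval_C, MvPolynomial.eval_X,
    eval_vandermondePoly]
  rw [mul_assoc, ← Finset.prod_mul_distrib]
  simp only [mul_assoc]

lemma poch_pos {c : ℝ} (hc : 0 < c) (m : ℕ) : 0 < poch c m :=
  Finset.prod_pos fun j _ => by positivity

lemma poch_add (c : ℝ) (i m : ℕ) : poch c (i + m) = poch c i * poch (c + i) m := by
  simp only [poch, Finset.prod_range_add, Nat.cast_add, add_assoc]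

lemma prod_range_sub_eq_poch (c : ℝ) (m : ℕ) :
    ∏ j ∈ Finset.range m, (c + m - 1 - j) = poch c m := by
  rw [poch, ← Finset.prod_range_reflect]
  refine Finset.prod_congr rfl fun j hj => ?_
  have : j + 1 ≤ m := Finset.mem_range.mp hj
  rw [Nat.sub_sub, add_comm 1 j, Nat.cast_sub this]
  push_cast
  ring

lemma poch_neg_natCast_mul_factorial {i n : ℕ} (hi : i ≤ n) :
    poch (-(n : ℝ)) i * (n - i).factorial = (-1) ^ i * n.factorial := by
  have h : ∀ m : ℕ, poch (-((i + m : ℕ) : ℝ)) i = (-1) ^ i * poch (m + 1 : ℝ) i := by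
    intro m
    have hsign : (-1 : ℝ) ^ i = ∏ _j ∈ Finset.range i, (-1) := by simp
    rw [← prod_range_sub_eq_poch ((m : ℝ) + 1), poch, hsign, ← Finset.prod_mul_distrib]
    refine Finset.prod_congr rfl fun j _ => ?_
    push_cast
    ring
  have hf : ∀ m : ℕ, poch (1 : ℝ) m = m.factorial := by
    intro m
    rw [poch, ← Finset.prod_range_add_one_eq_factorial]
    push_cast
    exact Finset.prod_congr rfl fun j _ => add_comm _ _
  obtain ⟨m, rfl⟩ := Nat.exists_eq_add_of_le hi
  rw [h, Nat.add_sub_cancel_left, ← hf, ← hf, add_comm i m, poch_add, add_comm (m : ℝ) 1]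
  ring

/-- Aomoto's integral formula for integer exponent: the integral equals
`(-1)^n 𝒮ₙ(a,b;k)` times the hypergeometric polynomial
`₂F₁(-n, n + a/k + b/k - 1; a/k; y)` (which is, up to the factor `(-2)^{-n}`,
the monic Jacobi polynomial `Pₙ^{a/k-1, b/k-1}(1-2y)`). -/
theorem aomoto_integral_formula (n k : ℕ) (hn : 1 ≤ n) (hk : 1 ≤ k)
    (a b : ℝ) (ha : 0 < a) (hb : 0 < b) (y : ℝ) :
    aomoto n k a b y =
      (-1 : ℝ) ^ n * selberg n k a b *
        (poch (a / k) n / poch (a / k + b / k + n - 1) n) *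
        ∑ i ∈ Finset.range (n + 1),
          poch (-(n : ℝ)) i * poch (a / k + b / k + n - 1) i /
            (poch (a / k) i * (Nat.factorial i : ℝ)) * y ^ i := by
  have hk' : (0 : ℝ) < k := by exact_mod_cast hk
  have hn' : (1 : ℝ) ≤ n := by exact_mod_cast hn
  have hA : 0 < a / k := by positivity
  have hB : 0 < b / k := by positivity
  have hC : 0 < a / k + b / k + n - 1 := by linarith
  have hmoment := fun S => (selberg_eq_selbergMoment n k ha hb).symm ▸
    selbergMoment_eq (n := n) (μ := fun m => ProbabilityTheory.beta (a + m) b) hk ha hb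
      (beta_succ_recurrence ha hb) S
  simp only [aomoto_eq_sum_selbergMoment n k ha hb, hmoment]
  rw [Finset.sum_powerset_apply_card (fun m => (-1) ^ m * y ^ (n - m) * (selberg n k a b *
      ∏ j ∈ Finset.range m, (a / k + n - 1 - j) / (a / k + b / k + 2 * n - 2 - j))),
    Finset.card_univ, Fintype.card_fin, ← Finset.sum_range_reflect, Finset.mul_sum]
  refine Finset.sum_congr rfl fun i hi => ?_
  obtain ⟨m, rfl⟩ := Nat.exists_eq_add_of_le (Nat.lt_succ_iff.mp (Finset.mem_range.mp hi))
  set A := a / k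
  set B := b / k
  have h1 : i + m + 1 - 1 - i = m := by omega
  have h2 : i + m - m = i := by omega
  set c := A + B + ((i + m : ℕ) : ℝ) - 1 with hc
  have hnum : ∏ j ∈ Finset.range m, (A + ((i + m : ℕ) : ℝ) - 1 - j) = poch (A + i) m := by
    rw [← prod_range_sub_eq_poch]
    push_cast
    simp only [add_assoc]
  have hden : ∏ j ∈ Finset.range m, (A + B + 2 * ((i + m : ℕ) : ℝ) - 2 - j) =
      poch (c + i) m := by
    rw [← prod_range_sub_eq_poch, hc]
    refine Finset.prod_congr rfl fun j _ => ?_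
    push_cast
    ring
  have hneg := poch_neg_natCast_mul_factorial (Nat.le_add_right i m)
  rw [Nat.add_sub_cancel_left] at hneg
  have hchoose : ((i + m).choose m : ℝ) * (i.factorial * m.factorial) = (i + m).factorial := by
    have := Nat.choose_mul_factorial_mul_factorial (Nat.le_add_left m i)
    rw [Nat.add_sub_cancel] at this
    rw [← this]
    push_cast
    ring
  rw [h1, h2, Finset.prod_div_distrib, hnum, hden, poch_add, poch_add, nsmul_eq_mul]
  have p1 := (poch_pos hA i).ne'
  have p2 := (poch_pos hC i).ne'
  have p3 := (poch_pos (show 0 < c + i by positivity) m).ne'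
  have f1 : (i.factorial : ℝ) ≠ 0 := by positivity
  have f2 : (m.factorial : ℝ) ≠ 0 := by positivity
  have hchoose' : ((i + m).choose m : ℝ) =
      (-1) ^ i * poch (-((i + m : ℕ) : ℝ)) i / i.factorial := by
    rw [eq_div_iff f1]
    refine mul_right_cancel₀ f2 ?_
    rw [mul_assoc, hchoose, mul_assoc, hneg, ← mul_assoc, ← mul_pow]
    simp
  rw [hchoose', pow_add]
  field_simp
end

section
/- First part of Selberg's proof (Gamma-quotient independence): Let n ≥ 1 and k ≥ 1 be integers. For real a, b > 0, set G_n(a,b;k) = ∏_{j=0}^{n−1} Γ(a+jk)·Γ(b+jk) / Γ(a+b+(n+j−1)k). Then the ratio 𝒮_n(a,b;k) / G_n(a,b;k) is independent of a and b; that is, for all a, b, a', b' > 0, 𝒮_n(a,b;k) · G_n(a',b';k) = 𝒮_n(a',b';k) · G_n(a,b;k). -/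
open MeasureTheory

/-- The Gamma-quotient `Gₙ(a,b;k) = ∏_{j=0}^{n-1} Γ(a+jk)Γ(b+jk)/Γ(a+b+(n+j-1)k)`. -/
noncomputable def gammaQuot (n k : ℕ) (a b : ℝ) : ℝ :=
  ∏ j ∈ Finset.range n,
    Real.Gamma (a + j * k) * Real.Gamma (b + j * k) /
      Real.Gamma (a + b + ((n : ℝ) + j - 1) * k)

/-- The pairs `i < j` of indices, which label the factors of the Vandermonde product. -/
abbrev OrderedPair (n : ℕ) : Type := {p : Fin n × Fin n // p.1 < p.2}

/-- The index of the variable picked in the factor `x_j - x_i`. -/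
def pickedIndex {n : ℕ} (p : OrderedPair n) (c : Bool) : Fin n :=
  bif c then p.1.2 else p.1.1

/-- The exponent of `x i` in the monomial given by a choice `f` of one variable in every factor
of `vandermonde x ^ m`. -/
def choiceExponent {n m : ℕ} (f : OrderedPair n × Fin m → Bool) (i : Fin n) : ℕ :=
  (Finset.univ.filter fun e => pickedIndex e.1 (f e) = i).card

lemma vandermonde_pow_eq_sum {n : ℕ} (m : ℕ) (x : Fin n → ℝ) :
    vandermonde x ^ m = ∑ f : OrderedPair n × Fin m → Bool,
      (∏ e, bif f e then (1 : ℝ) else -1) * ∏ i, x i ^ choiceExponent f i := by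
  have hv : vandermonde x ^ m = ∏ e : OrderedPair n × Fin m,
      ∑ c : Bool, (bif c then (1 : ℝ) else -1) * x (pickedIndex e.1 c) := by
    rw [Fintype.prod_prod_type]
    simp only [Fintype.sum_bool, cond_true, cond_false, pickedIndex, Finset.prod_const,
      Finset.card_univ, Fintype.card_fin, Finset.prod_pow]
    congr 1
    rw [vandermonde, ← Finset.prod_subtype_eq_prod_filter]
    simp [sub_eq_add_neg]
  rw [hv, Finset.prod_univ_sum, Fintype.piFinset_univ]
  refine Finset.sum_congr rfl fun f _ => ?_
  rw [Finset.prod_mul_distrib]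
  congr 1
  rw [← Finset.prod_fiberwise' Finset.univ (fun e => pickedIndex e.1 (f e)) x]
  simp [choiceExponent]

lemma two_mul_card_orderedPair_mem {n : ℕ} (T : Finset (Fin n)) :
    2 * (Finset.univ.filter fun p : OrderedPair n => p.1.1 ∈ T ∧ p.1.2 ∈ T).card =
      T.card * (T.card - 1) := by
  rw [Nat.mul_sub_one, ← Finset.offDiag_card,
    ← Finset.card_filter_add_card_filter_not (s := T.offDiag) (fun p => p.1 < p.2), two_mul]
  congr 1
  · refine Finset.card_bij (fun p _ => p.1) ?_ ?_ ?_
    · simp +contextual [Finset.mem_offDiag]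
      intro a b hab _ _
      exact hab.ne
    · simp
    · simp +contextual [Finset.mem_offDiag]
  · refine Finset.card_bij (fun p _ => p.1.swap) ?_ ?_ ?_
    · simp +contextual [Finset.mem_offDiag]
      intro a b hab _ _
      exact ⟨hab.ne', hab.le⟩
    · intro p _ q _ h
      exact Subtype.ext (Prod.swap_injective h)
    · simp only [Finset.mem_filter, Finset.mem_offDiag, Prod.forall]
      rintro a b ⟨⟨ha, hb, hab⟩, hlt⟩
      exact ⟨⟨(b, a), lt_of_le_of_ne (not_lt.1 hlt) (Ne.symm hab)⟩, by simp [ha, hb], rfl⟩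

lemma sum_choiceExponent {n m : ℕ} (f : OrderedPair n × Fin m → Bool) (T : Finset (Fin n)) :
    ∑ i ∈ T, choiceExponent f i =
      (Finset.univ.filter fun e => pickedIndex e.1 (f e) ∈ T).card := by
  rw [Finset.card_eq_sum_card_fiberwise (f := fun e => pickedIndex e.1 (f e)) (t := T)
    (by intro e he; simpa using he)]
  refine Finset.sum_congr rfl fun i hi => ?_
  rw [choiceExponent, Finset.filter_filter]
  congr 1
  ext e
  simp only [Finset.mem_filter, Finset.mem_univ, true_and]
  constructor
  · rintro rfl
    exact ⟨hi, rfl⟩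
  · exact And.right

lemma le_sum_choiceExponent {n k : ℕ} (f : OrderedPair n × Fin (2 * k) → Bool)
    (T : Finset (Fin n)) : k * (T.card * (T.card - 1)) ≤ ∑ i ∈ T, choiceExponent f i := by
  rw [sum_choiceExponent, ← two_mul_card_orderedPair_mem, mul_left_comm, ← mul_assoc, mul_comm]
  calc _ = ((Finset.univ.filter fun p : OrderedPair n => p.1.1 ∈ T ∧ p.1.2 ∈ T) ×ˢ
        (Finset.univ : Finset (Fin (2 * k)))).card := by simp [Finset.card_product]
    _ ≤ _ := by
      refine Finset.card_le_card fun e he => ?_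
      simp only [Finset.mem_product, Finset.mem_filter, Finset.mem_univ, true_and,
        and_true] at he ⊢
      cases h : f e <;> simp [pickedIndex, he]

lemma sum_univ_choiceExponent {n k : ℕ} (f : OrderedPair n × Fin (2 * k) → Bool) :
    ∑ i, choiceExponent f i = k * (n * (n - 1)) := by
  have h := two_mul_card_orderedPair_mem (Finset.univ : Finset (Fin n))
  simp only [Finset.mem_univ, and_self, Finset.filter_true, Finset.card_univ,
    Fintype.card_fin] at h
  rw [sum_choiceExponent, ← h]
  simp only [Finset.mem_univ, Finset.filter_true, Finset.card_univ, Fintype.card_prod,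
    Fintype.card_fin]
  ring

/-- Exponents in increasing order whose partial sums are at least those of `Δ(x) ^ (2 * k)` lie
within the bounds found by Selberg. -/
lemma selberg_exponent_bounds {n k : ℕ} {α : Fin n → ℕ} (hα : Monotone α)
    (hle : ∀ T : Finset (Fin n), k * (T.card * (T.card - 1)) ≤ ∑ i ∈ T, α i)
    (hsum : ∑ i, α i = k * (n * (n - 1))) (j : Fin n) :
    j * k ≤ α j ∧ α j ≤ (n - 1 + j) * k := by
  constructor
  · have h := (hle (Finset.Iic j)).trans
      (Finset.sum_le_card_nsmul _ _ (α j) fun i hi => hα (Finset.mem_Iic.1 hi))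
    simp only [Fin.card_Iic, Nat.add_sub_cancel, smul_eq_mul] at h
    refine Nat.le_of_mul_le_mul_left (c := j.1 + 1) ?_ (Nat.succ_pos _)
    calc _ = k * ((j + 1) * j) := by ring
      _ ≤ _ := h
  · have h₁ := hle (Finset.Iio j)
    have h₂ : (Finset.Ici j).card • α j ≤ ∑ i ∈ Finset.Ici j, α i :=
      Finset.card_nsmul_le_sum _ _ _ fun i hi => hα (Finset.mem_Ici.1 hi)
    have h₃ : ∑ i ∈ Finset.Iio j, α i + ∑ i ∈ Finset.Ici j, α i = ∑ i, α i := by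
      rw [← Finset.sum_union]
      · congr 1
        ext i
        simp [lt_or_ge]
      · rw [Finset.disjoint_left]
        intro i hi hi'
        exact absurd (Finset.mem_Iio.1 hi) (Finset.mem_Ici.1 hi').not_gt
    rw [hsum] at h₃
    simp only [Fin.card_Iio, Fin.card_Ici, smul_eq_mul] at h₁ h₂
    have hj := j.2
    obtain ⟨d, hd⟩ : ∃ d, n = j + (d + 1) := ⟨n - j - 1, by omega⟩
    have hn : n - j = d + 1 := by omega
    have hn' : n - 1 = j + d := by omega
    rw [hn] at h₂
    rw [hn'] at h₃ ⊢
    refine Nat.le_of_mul_le_mul_left (c := d + 1) ?_ (Nat.succ_pos _)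
    have h₄ : ∀ i : ℕ, k * ((i + (d + 1)) * (i + d)) =
        k * (i * (i - 1)) + (d + 1) * ((i + d + i) * k) := by
      rintro (_ | i)
      · ring
      · rw [Nat.add_sub_cancel]
        ring
    have h₅ := h₄ j
    rw [← hd] at h₅
    omega

lemma choiceExponent_sort_bounds {n k : ℕ} (f : OrderedPair n × Fin (2 * k) → Bool) (j : Fin n) :
    j * k ≤ choiceExponent f (Tuple.sort (choiceExponent f) j) ∧
      choiceExponent f (Tuple.sort (choiceExponent f) j) ≤ (n - 1 + j) * k := by
  refine selberg_exponent_bounds (Tuple.monotone_sort (choiceExponent f)) (fun T => ?_) ?_ j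
  · have h := le_sum_choiceExponent f (T.map (Tuple.sort (choiceExponent f)).toEmbedding)
    simpa using h
  · rw [← sum_univ_choiceExponent f]
    exact Equiv.sum_comp (Tuple.sort (choiceExponent f)) (choiceExponent f)

lemma integrableOn_rpow_mul_one_sub_rpow {a b : ℝ} (ha : 0 < a) (hb : 0 < b) :
    IntegrableOn (fun x : ℝ => x ^ (a - 1) * (1 - x) ^ (b - 1)) (Set.Icc 0 1) ∧
    ∫ x in Set.Icc (0 : ℝ) 1, x ^ (a - 1) * (1 - x) ^ (b - 1) =
      Real.Gamma a * Real.Gamma b / Real.Gamma (a + b) := by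
  have hpdf := ProbabilityTheory.lintegral_betaPDF_eq_one ha hb
  have hB := ProbabilityTheory.beta_pos ha hb
  have hnn : 0 ≤ᵐ[volume.restrict (Set.Ioo (0 : ℝ) 1)]
      fun x => 1 / ProbabilityTheory.beta a b * x ^ (a - 1) * (1 - x) ^ (b - 1) := by
    filter_upwards [ae_restrict_mem measurableSet_Ioo] with x hx
    have h₁ := hx.1
    have h₂ : 0 < 1 - x := sub_pos.2 hx.2
    positivity
  have hm : AEStronglyMeasurable
      (fun x : ℝ => 1 / ProbabilityTheory.beta a b * x ^ (a - 1) * (1 - x) ^ (b - 1))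
      (volume.restrict (Set.Ioo (0 : ℝ) 1)) := by
    have : Measurable
      (fun x : ℝ => 1 / ProbabilityTheory.beta a b * x ^ (a - 1) * (1 - x) ^ (b - 1)) := by
      fun_prop
    exact this.aestronglyMeasurable
  rw [ProbabilityTheory.lintegral_betaPDF] at hpdf
  have hint : IntegrableOn
      (fun x : ℝ => 1 / ProbabilityTheory.beta a b * x ^ (a - 1) * (1 - x) ^ (b - 1))
      (Set.Ioo (0 : ℝ) 1) :=
    ⟨hm, by rw [hasFiniteIntegral_iff_ofReal hnn, hpdf]; exact ENNReal.one_lt_top⟩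
  have hval : ∫ x in Set.Ioo (0 : ℝ) 1,
      1 / ProbabilityTheory.beta a b * x ^ (a - 1) * (1 - x) ^ (b - 1) = 1 := by
    rw [integral_eq_lintegral_of_nonneg_ae hnn hm, hpdf, ENNReal.toReal_one]
  simp only [mul_assoc] at hint hval
  rw [integrableOn_Icc_iff_integrableOn_Ioo, integral_Icc_eq_integral_Ioo]
  constructor
  · have h := hint.const_mul (ProbabilityTheory.beta a b)
    refine h.congr (Filter.Eventually.of_forall fun x => ?_)
    field_simp
  · rw [integral_const_mul] at hval
    change _ = ProbabilityTheory.beta a b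
    field_simp at hval
    exact hval

lemma integrableOn_pow_mul_beta {a b : ℝ} (ha : 0 < a) (hb : 0 < b) (m : ℕ) :
    IntegrableOn (fun x : ℝ => x ^ m * (x ^ (a - 1) * (1 - x) ^ (b - 1))) (Set.Icc 0 1) ∧
    ∫ x in Set.Icc (0 : ℝ) 1, x ^ m * (x ^ (a - 1) * (1 - x) ^ (b - 1)) =
      Real.Gamma (a + m) * Real.Gamma b / Real.Gamma (a + b + m) := by
  obtain ⟨hi, hv⟩ := integrableOn_rpow_mul_one_sub_rpow (a := a + m) (by positivity) hb
  have he : ∀ x ∈ Set.Ioo (0 : ℝ) 1, x ^ (a + m - 1) * (1 - x) ^ (b - 1) =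
      x ^ m * (x ^ (a - 1) * (1 - x) ^ (b - 1)) := by
    intro x hx
    rw [add_sub_right_comm, Real.rpow_add_natCast hx.1.ne']
    ring
  rw [integrableOn_Icc_iff_integrableOn_Ioo] at hi ⊢
  rw [integral_Icc_eq_integral_Ioo] at hv ⊢
  refine ⟨hi.congr_fun he measurableSet_Ioo, ?_⟩
  rw [← setIntegral_congr_fun measurableSet_Ioo he, hv, add_right_comm]

lemma selberg_eq_sum (n k : ℕ) {a b : ℝ} (ha : 0 < a) (hb : 0 < b) :
    selberg n k a b = ∑ f : OrderedPair n × Fin (2 * k) → Bool,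
      (∏ e, bif f e then (1 : ℝ) else -1) *
        ∏ i, (Real.Gamma (a + choiceExponent f i) * Real.Gamma b /
          Real.Gamma (a + b + choiceExponent f i)) := by
  have hexp : ∀ x : Fin n → ℝ,
      vandermonde x ^ (2 * k) * ∏ i, x i ^ (a - 1) * (1 - x i) ^ (b - 1) =
      ∑ f : OrderedPair n × Fin (2 * k) → Bool, (∏ e, bif f e then (1 : ℝ) else -1) *
        ∏ i, (x i ^ choiceExponent f i * (x i ^ (a - 1) * (1 - x i) ^ (b - 1))) := by
    intro x
    rw [vandermonde_pow_eq_sum, Finset.sum_mul]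
    refine Finset.sum_congr rfl fun f _ => ?_
    rw [mul_assoc, ← Finset.prod_mul_distrib]
  rw [selberg, volume_pi, Measure.restrict_pi_pi]
  simp only [hexp]
  rw [integral_finsetSum]
  · refine Finset.sum_congr rfl fun f _ => ?_
    rw [integral_const_mul, integral_fintype_prod_eq_prod
      (f := fun i (t : ℝ) => t ^ choiceExponent f i * (t ^ (a - 1) * (1 - t) ^ (b - 1)))]
    simp only [(integrableOn_pow_mul_beta ha hb _).2]
  · intro f _
    refine Integrable.const_mul ?_ _
    exact Integrable.fintype_prod
      (f := fun i (t : ℝ) => t ^ choiceExponent f i * (t ^ (a - 1) * (1 - t) ^ (b - 1)))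
      fun i => (integrableOn_pow_mul_beta ha hb _).1

lemma vandermonde_one_sub {n : ℕ} (x : Fin n → ℝ) (k : ℕ) :
    vandermonde (1 - x) ^ (2 * k) = vandermonde x ^ (2 * k) := by
  simp only [pow_mul, vandermonde, ← Finset.prod_pow]
  refine Finset.prod_congr rfl fun p _ => congrArg (fun t : ℝ => t ^ k) ?_
  simp only [Pi.sub_apply, Pi.one_apply]
  ring

lemma selberg_symm (n k : ℕ) (a b : ℝ) : selberg n k a b = selberg n k b a := by
  have hs : MeasurableSet (Set.univ.pi fun _ : Fin n => Set.Icc (0 : ℝ) 1) :=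
    MeasurableSet.univ_pi fun _ => measurableSet_Icc
  rw [selberg, selberg, ← integral_indicator hs, ← integral_indicator hs,
    ← integral_sub_left_eq_self _ volume (1 : Fin n → ℝ)]
  congr 1
  ext x
  have hmem : (1 - x ∈ Set.univ.pi fun _ : Fin n => Set.Icc (0 : ℝ) 1) ↔
      x ∈ Set.univ.pi fun _ : Fin n => Set.Icc (0 : ℝ) 1 := by
    simp only [Set.mem_univ_pi, Set.mem_Icc, Pi.sub_apply, Pi.one_apply]
    refine forall_congr' fun i => ?_
    constructor <;> rintro ⟨h₁, h₂⟩ <;> constructor <;> linarith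
  by_cases hx : x ∈ Set.univ.pi fun _ : Fin n => Set.Icc (0 : ℝ) 1
  · rw [Set.indicator_of_mem (hmem.2 hx), Set.indicator_of_mem hx, vandermonde_one_sub]
    simp [mul_comm]
  · rw [Set.indicator_of_notMem (mt hmem.1 hx), Set.indicator_of_notMem hx]

lemma gamma_add_natCast {x : ℝ} (hx : 0 < x) (m : ℕ) :
    Real.Gamma (x + m) = (ascPochhammer ℝ m).eval x * Real.Gamma x := by
  induction m with
  | zero => simp
  | succ m ih =>
    rw [Nat.cast_succ, ← add_assoc, Real.Gamma_add_one (by positivity), ih,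
      ascPochhammer_succ_eval]
    ring

/-- The exponents of the monomial given by a choice `f`, in increasing order. -/
def sortedExponent {n m : ℕ} (f : OrderedPair n × Fin m → Bool) (j : Fin n) : ℕ :=
  choiceExponent f (Tuple.sort (choiceExponent f) j)

/-- The polynomial in `a` and `b` which `selberg n k a b` contributes beyond Gamma factors. -/
noncomputable def selbergNumerator (n k : ℕ) (a b : ℝ) : ℝ :=
  ∑ f : OrderedPair n × Fin (2 * k) → Bool, (∏ e, bif f e then (1 : ℝ) else -1) *
    ∏ j : Fin n, ((ascPochhammer ℝ (sortedExponent f j - j * k)).eval (a + j * k) *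
      (ascPochhammer ℝ ((n - 1 + j) * k - sortedExponent f j)).eval (a + b + sortedExponent f j))

/-- The product of the rising factorials of lengths `0, k, …, (n - 1) * k`. -/
noncomputable def risingProduct (n k : ℕ) : Polynomial ℝ :=
  ∏ j : Fin n, ascPochhammer ℝ (j * k)

lemma beta_mul_ascPochhammer {a b : ℝ} (ha : 0 < a) (hb : 0 < b) {l m N : ℕ} (hl : l ≤ m)
    (hN : m ≤ N) :
    Real.Gamma (a + m) * Real.Gamma b / Real.Gamma (a + b + m) * (ascPochhammer ℝ l).eval b =
      (ascPochhammer ℝ (m - l)).eval (a + l) * (ascPochhammer ℝ (N - m)).eval (a + b + m) *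
        (Real.Gamma (a + l) * Real.Gamma (b + l) / Real.Gamma (a + b + N)) := by
  have h₁ := gamma_add_natCast (x := a + l) (by positivity) (m - l)
  have h₂ := gamma_add_natCast (x := a + b + m) (by positivity) (N - m)
  have h₃ := gamma_add_natCast hb l
  rw [add_assoc, ← Nat.cast_add, Nat.add_sub_cancel' hl] at h₁
  rw [add_assoc, ← Nat.cast_add, Nat.add_sub_cancel' hN] at h₂
  have hm : Real.Gamma (a + b + m) ≠ 0 := (Real.Gamma_pos_of_pos (by positivity)).ne'
  have hp : (ascPochhammer ℝ (N - m)).eval (a + b + m) ≠ 0 :=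
    (ascPochhammer_pos _ _ (by positivity)).ne'
  rw [h₁, h₂, h₃]
  field_simp

lemma selberg_mul_risingProduct {n k : ℕ} {a b : ℝ} (ha : 0 < a) (hb : 0 < b) :
    selberg n k a b * (risingProduct n k).eval b =
      selbergNumerator n k a b * gammaQuot n k a b := by
  rw [selberg_eq_sum n k ha hb, selbergNumerator, Finset.sum_mul, Finset.sum_mul]
  refine Finset.sum_congr rfl fun f _ => ?_
  rw [← Equiv.prod_comp (Tuple.sort (choiceExponent f)), risingProduct, Polynomial.eval_prod,
    gammaQuot, Finset.prod_range, mul_assoc, mul_assoc, ← Finset.prod_mul_distrib,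
    ← Finset.prod_mul_distrib]
  refine congrArg _ (Finset.prod_congr rfl fun j _ => ?_)
  obtain ⟨hl, hN⟩ := choiceExponent_sort_bounds f j
  have h := beta_mul_ascPochhammer ha hb hl hN
  have hn : 1 ≤ n := j.pos
  push_cast [Nat.cast_sub hn] at h
  rw [sub_add_eq_add_sub] at h
  exact h

lemma gammaQuot_pos {n k : ℕ} {a b : ℝ} (ha : 0 < a) (hb : 0 < b) : 0 < gammaQuot n k a b := by
  refine Finset.prod_pos fun j hj => ?_
  have hn : (1 : ℝ) ≤ n := by exact_mod_cast (Finset.mem_range.1 hj).pos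
  have h : 0 ≤ ((n : ℝ) + j - 1) * k :=
    mul_nonneg (by linarith [Nat.cast_nonneg (α := ℝ) j]) (Nat.cast_nonneg k)
  have h₁ := Real.Gamma_pos_of_pos (s := a + j * k) (by positivity)
  have h₂ := Real.Gamma_pos_of_pos (s := b + j * k) (by positivity)
  have h₃ := Real.Gamma_pos_of_pos (s := a + b + ((n : ℝ) + j - 1) * k) (by positivity)
  positivity

lemma gammaQuot_symm (n k : ℕ) (a b : ℝ) : gammaQuot n k a b = gammaQuot n k b a := by
  refine Finset.prod_congr rfl fun j _ => ?_
  rw [mul_comm, add_comm a b]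

lemma risingProduct_monic (n k : ℕ) : (risingProduct n k).Monic :=
  Polynomial.monic_prod_of_monic _ _ fun _ _ => monic_ascPochhammer ℝ _

lemma natDegree_risingProduct (n k : ℕ) :
    (risingProduct n k).natDegree = ∑ j : Fin n, j * k := by
  rw [risingProduct, Polynomial.natDegree_prod_of_monic _ _ fun _ _ => monic_ascPochhammer ℝ _]
  simp only [ascPochhammer_natDegree]

lemma risingProduct_eval_pos (n k : ℕ) {a : ℝ} (ha : 0 < a) : 0 < (risingProduct n k).eval a := by
  rw [risingProduct, Polynomial.eval_prod]
  exact Finset.prod_pos fun j _ => ascPochhammer_pos _ _ ha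

lemma sum_sub_sortedExponent {n k : ℕ} (f : OrderedPair n × Fin (2 * k) → Bool) :
    ∑ j : Fin n, ((n - 1 + j) * k - sortedExponent f j) = ∑ j : Fin n, j * k := by
  have hsum : ∑ j, sortedExponent f j = k * (n * (n - 1)) := by
    rw [← sum_univ_choiceExponent f]
    exact Equiv.sum_comp (Tuple.sort (choiceExponent f)) (choiceExponent f)
  have h : ∑ j : Fin n, ((n - 1 + j) * k - sortedExponent f j) + ∑ j, sortedExponent f j =
      ∑ j : Fin n, (n - 1 + j) * k := by
    rw [← Finset.sum_add_distrib]
    exact Finset.sum_congr rfl fun j _ => Nat.sub_add_cancel (choiceExponent_sort_bounds f j).2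
  simp only [add_mul, Finset.sum_add_distrib, Finset.sum_const, Finset.card_univ,
    Fintype.card_fin, smul_eq_mul] at h
  have h' : n * ((n - 1) * k) = k * (n * (n - 1)) := by ring
  simp only [add_mul]
  omega

open Polynomial in
lemma exists_polynomial_selbergNumerator_right (n k : ℕ) (a : ℝ) :
    ∃ P : ℝ[X], P.natDegree ≤ (risingProduct n k).natDegree ∧
      ∀ b, P.eval b = selbergNumerator n k a b := by
  refine ⟨∑ f : OrderedPair n × Fin (2 * k) → Bool, C (∏ e, bif f e then (1 : ℝ) else -1) *
    ∏ j : Fin n, (C ((ascPochhammer ℝ (sortedExponent f j - j * k)).eval (a + j * k)) *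
      (ascPochhammer ℝ ((n - 1 + j) * k - sortedExponent f j)).comp
        (X + C (a + sortedExponent f j))), ?_, fun b => ?_⟩
  · refine natDegree_sum_le_of_forall_le _ _ fun f _ => ?_
    refine (natDegree_C_mul_le _ _).trans ((natDegree_prod_le _ _).trans ?_)
    rw [natDegree_risingProduct, ← sum_sub_sortedExponent f]
    refine Finset.sum_le_sum fun j _ => (natDegree_C_mul_le _ _).trans ?_
    rw [natDegree_comp, natDegree_X_add_C, mul_one, ascPochhammer_natDegree]
  · simp only [eval_finsetSum, eval_mul, eval_prod, eval_C, eval_comp, eval_add, eval_X,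
      selbergNumerator]
    refine Finset.sum_congr rfl fun f _ => congrArg _ (Finset.prod_congr rfl fun j _ => ?_)
    rw [← add_assoc, add_comm b a]

open Polynomial in
lemma exists_polynomial_selbergNumerator_left (n k : ℕ) (a : ℝ) :
    ∃ Q : ℝ[X], ∀ b, Q.eval b = selbergNumerator n k b a := by
  refine ⟨∑ f : OrderedPair n × Fin (2 * k) → Bool, C (∏ e, bif f e then (1 : ℝ) else -1) *
    ∏ j : Fin n, ((ascPochhammer ℝ (sortedExponent f j - j * k)).comp (X + C ((j : ℝ) * k)) *
      (ascPochhammer ℝ ((n - 1 + j) * k - sortedExponent f j)).comp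
        (X + C (a + sortedExponent f j))), fun b => ?_⟩
  simp only [eval_finsetSum, eval_mul, eval_prod, eval_C, eval_comp, eval_add, eval_X,
    selbergNumerator, add_assoc]

lemma selbergNumerator_symm {n k : ℕ} {a b : ℝ} (ha : 0 < a) (hb : 0 < b) :
    selbergNumerator n k b a * (risingProduct n k).eval b =
      (risingProduct n k).eval a * selbergNumerator n k a b := by
  have h₁ := selberg_mul_risingProduct (n := n) (k := k) ha hb
  have h₂ := selberg_mul_risingProduct (n := n) (k := k) hb ha
  rw [selberg_symm, gammaQuot_symm] at h₂
  refine mul_right_cancel₀ (gammaQuot_pos (n := n) (k := k) ha hb).ne' ?_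
  linear_combination (risingProduct n k).eval a * h₁ - (risingProduct n k).eval b * h₂

open Polynomial in
lemma selbergNumerator_left_const {n k : ℕ} {a b b' : ℝ} (ha : 0 < a) :
    selbergNumerator n k b a = selbergNumerator n k b' a := by
  obtain ⟨P, hdeg, hP⟩ := exists_polynomial_selbergNumerator_right n k a
  obtain ⟨Q, hQ⟩ := exists_polynomial_selbergNumerator_left n k a
  have h : Q * risingProduct n k = C ((risingProduct n k).eval a) * P := by
    refine eq_of_infinite_eval_eq _ _ ((Set.Ioi_infinite (0 : ℝ)).mono fun b hb => ?_)
    simp only [Set.mem_ofPred_eq, eval_mul, eval_C, hP, hQ]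
    exact selbergNumerator_symm ha hb
  have hQ0 : Q.natDegree = 0 := by
    by_cases h0 : Q = 0
    · rw [h0, natDegree_zero]
    have hd := (risingProduct_monic n k).natDegree_mul' h0
    rw [mul_comm, h] at hd
    have := natDegree_C_mul_le ((risingProduct n k).eval a) P
    omega
  rw [← hQ, ← hQ, eq_C_of_natDegree_eq_zero hQ0, eval_C, eval_C]

lemma selberg_mul_gammaQuot_left {n k : ℕ} {a b b' : ℝ} (ha : 0 < a) (hb : 0 < b)
    (hb' : 0 < b') :
    selberg n k b a * gammaQuot n k b' a = selberg n k b' a * gammaQuot n k b a := by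
  refine mul_right_cancel₀ (risingProduct_eval_pos n k ha).ne' ?_
  have h₁ := selberg_mul_risingProduct (n := n) (k := k) hb ha
  have h₂ := selberg_mul_risingProduct (n := n) (k := k) hb' ha
  rw [selbergNumerator_left_const (b' := b') ha] at h₁
  linear_combination gammaQuot n k b' a * h₁ - gammaQuot n k b a * h₂

/-- First part of Selberg's proof: the ratio `𝒮ₙ(a,b;k) / Gₙ(a,b;k)` is
independent of `a` and `b`. -/
theorem selberg_gamma_ratio_independent (n k : ℕ) (hn : 1 ≤ n) (hk : 1 ≤ k)
    (a b a' b' : ℝ) (ha : 0 < a) (hb : 0 < b) (ha' : 0 < a') (hb' : 0 < b') :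
    selberg n k a b * gammaQuot n k a' b' = selberg n k a' b' * gammaQuot n k a b := by
  have h₁ := selberg_mul_gammaQuot_left (n := n) (k := k) hb ha ha'
  have h₂ := selberg_mul_gammaQuot_left (n := n) (k := k) ha' hb hb'
  simp only [selberg_symm n k _ a', gammaQuot_symm n k _ a'] at h₂
  refine mul_right_cancel₀ (gammaQuot_pos (n := n) (k := k) ha' hb).ne' ?_
  linear_combination gammaQuot n k a' b' * h₁ + gammaQuot n k a b * h₂
end
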